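/- Let G be a finite DAG with n nodes and maximum indegree Δ, let 0 < ε < 1, and let R ≥ Δ + 1. In the compcost model, in every valid pebbling of G with R red pebbles that has minimum cost among all such pebblings, the total number of moves of types (3) and (4) is at most (2/ε)·(2Δ + 1 + ε)·n; consequently the total number of moves of the pebbling is at most (1 + 2/ε)·(2Δ + 1 + ε)·n. -/

import Mathlib

namespace RBPebble

open scoped Classical

/-- A pebble is either red (fast memory) or blue (slow memory). -/
inductive Peb : Type
  | red
  | blue
  deriving DecidableEq

/-- The four kinds of moves of a red-blue pebbling. -/
inductive Move (V : Type) : Type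
  | toRed (v : V)    -- (1) replace a blue pebble by a red pebble
  | toBlue (v : V)   -- (2) replace a red pebble by a blue pebble
  | compute (v : V)  -- (3) place a red pebble on a node whose in-neighbors are all red
  | delete (v : V)   -- (4) delete a pebble
  deriving DecidableEq

variable {V : Type}

/-- A configuration assigns to each node no pebble, a red pebble, or a blue pebble. -/
def Config (V : Type) : Type := V → Option Peb

/-- The initial configuration: no pebbles anywhere. -/
def initConfig : Config V := fun _ => none

/-- The effect of a move on a configuration. -/
def applyMove [DecidableEq V] (c : Config V) : Move V → Config V
  | .toRed v => Function.update c v (some Peb.red)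
  | .toBlue v => Function.update c v (some Peb.blue)
  | .compute v => Function.update c v (some Peb.red)
  | .delete v => Function.update c v none

/-- The number of red pebbles in a configuration. -/
noncomputable def redCount [Fintype V] (c : Config V) : ℕ :=
  (Finset.univ.filter fun v => c v = some Peb.red).card

/-- Legality of a move in a given configuration (base model). -/
def legalMove (edge : V → V → Prop) (c : Config V) : Move V → Prop
  | .toRed v => c v = some Peb.blue
  | .toBlue v => c v = some Peb.red
  | .compute v => ∀ u, edge u v → c u = some Peb.red
  | .delete v => c v ≠ none

/-- A sequence of moves is valid from a configuration: every move is legal and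
at every point at most `R` red pebbles are on the graph. -/
def ValidFrom [Fintype V] [DecidableEq V] (edge : V → V → Prop) (R : ℕ) :
    Config V → List (Move V) → Prop
  | _, [] => True
  | c, m :: ms =>
      legalMove edge c m ∧ redCount (applyMove c m) ≤ R ∧
        ValidFrom edge R (applyMove c m) ms

/-- Running a list of moves from a configuration. -/
def runMoves [DecidableEq V] (c : Config V) : List (Move V) → Config V
  | [] => c
  | m :: ms => runMoves (applyMove c m) ms

/-- A sink: a node with no outgoing edge. -/
def IsSink (edge : V → V → Prop) (v : V) : Prop := ∀ u, ¬ edge v u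

/-- A source: a node with no incoming edge. -/
def IsSource (edge : V → V → Prop) (v : V) : Prop := ∀ u, ¬ edge u v

/-- A valid pebbling of the DAG with `R` red pebbles: starts from the empty
configuration, is valid throughout, and in the final configuration every sink
carries a pebble (of either color). -/
def IsPebbling [Fintype V] [DecidableEq V] (edge : V → V → Prop) (R : ℕ)
    (moves : List (Move V)) : Prop :=
  ValidFrom edge R initConfig moves ∧
    ∀ v, IsSink edge v → runMoves initConfig moves v ≠ none

def isTransfer : Move V → Bool
  | .toRed _ => true
  | .toBlue _ => true
  | _ => false

def isCompute : Move V → Bool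
  | .compute _ => true
  | _ => false

def isDelete : Move V → Bool
  | .delete _ => true
  | _ => false

/-- The cost of a pebbling: the number of moves of types (1) and (2). -/
def cost (moves : List (Move V)) : ℕ := (moves.filter isTransfer).length

/-- The number of compute moves (type (3)). -/
def computeCount (moves : List (Move V)) : ℕ := (moves.filter isCompute).length

/-- The number of delete moves (type (4)). -/
def deleteCount (moves : List (Move V)) : ℕ := (moves.filter isDelete).length

/-- The cost in the compcost model: transfers plus `ε` times the computes. -/
noncomputable def ccCost (ε : ℝ) (moves : List (Move V)) : ℝ :=
  (cost moves : ℝ) + ε * (computeCount moves : ℝ)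

/-- The oneshot restriction: each node is computed at most once. -/
def Oneshot [DecidableEq V] (moves : List (Move V)) : Prop :=
  ∀ v : V, moves.count (Move.compute v) ≤ 1

/-- The nodel restriction: no delete moves are used. -/
def NoDel (moves : List (Move V)) : Prop := ∀ m ∈ moves, isDelete m = false

/-- The indegree of a node. -/
noncomputable def indeg [Fintype V] (edge : V → V → Prop) (v : V) : ℕ :=
  (Finset.univ.filter fun u => edge u v).card

/-- The edge relation is acyclic (the graph is a DAG). -/
def Acyclic (edge : V → V → Prop) : Prop :=
  ∀ v, ¬ Relation.TransGen edge v v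

/-- The optimal cost of a valid pebbling with `R` red pebbles in the oneshot model. -/
noncomputable def optCost [Fintype V] [DecidableEq V] (edge : V → V → Prop) (R : ℕ) : ℕ :=
  sInf {c | ∃ moves : List (Move V),
    IsPebbling edge R moves ∧ Oneshot moves ∧ cost moves = c}

section Counting

theorem length_eq_cost_add_computeCount_add_deleteCount (ms : List (Move V)) :
    ms.length = cost ms + (computeCount ms + deleteCount ms) := by
  induction ms with
  | nil => rfl
  | cons m ms ih =>
    cases m <;> simp [cost, computeCount, deleteCount, List.filter_cons, isTransfer, isCompute,
      isDelete] at ih ⊢ <;> omega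

theorem cost_append (ms ms' : List (Move V)) : cost (ms ++ ms') = cost ms + cost ms' := by
  simp [cost]

theorem computeCount_append (ms ms' : List (Move V)) :
    computeCount (ms ++ ms') = computeCount ms + computeCount ms' := by
  simp [computeCount]

section ApplyMove

variable [DecidableEq V] (c : Config V) (v u : V)

theorem applyMove_toRed :
    applyMove c (.toRed v) u = if u = v then some .red else c u :=
  Function.update_apply _ _ _ _

theorem applyMove_toBlue :
    applyMove c (.toBlue v) u = if u = v then some .blue else c u :=
  Function.update_apply _ _ _ _

theorem applyMove_compute :
    applyMove c (.compute v) u = if u = v then some .red else c u :=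
  Function.update_apply _ _ _ _

theorem applyMove_delete :
    applyMove c (.delete v) u = if u = v then none else c u :=
  Function.update_apply _ _ _ _

end ApplyMove

variable [Fintype V]

/-- The set of nodes carrying a pebble. -/
noncomputable def pebbled (c : Config V) : Finset V := Finset.univ.filter fun v => c v ≠ none

theorem mem_pebbled {c : Config V} {v : V} : v ∈ pebbled c ↔ c v ≠ none := by
  simp [pebbled]

variable [DecidableEq V] {edge : V → V → Prop} {R : ℕ}

/-- Only computing creates pebbles, so deletions are paid for by computations and by the
pebbles present at the start. -/
theorem ValidFrom.deleteCount_le {c : Config V} {ms : List (Move V)}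
    (h : ValidFrom edge R c ms) : deleteCount ms ≤ computeCount ms + (pebbled c).card := by
  induction ms generalizing c with
  | nil => simp [deleteCount]
  | cons m ms ih =>
    obtain ⟨hl, -, hv⟩ := h
    have := ih hv
    cases m with
    | toRed v =>
      have e : pebbled (applyMove c (.toRed v)) ⊆ pebbled c := fun u hu => by
        simp only [legalMove] at hl
        by_cases huv : u = v <;> simp_all [mem_pebbled, applyMove_toRed]
      have := Finset.card_le_card e
      simp [computeCount, deleteCount, isCompute, isDelete] at *
      omega
    | toBlue v =>
      have e : pebbled (applyMove c (.toBlue v)) ⊆ pebbled c := fun u hu => by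
        simp only [legalMove] at hl
        by_cases huv : u = v <;> simp_all [mem_pebbled, applyMove_toBlue]
      have := Finset.card_le_card e
      simp [computeCount, deleteCount, isCompute, isDelete] at *
      omega
    | compute v =>
      have e : pebbled (applyMove c (.compute v)) ⊆ insert v (pebbled c) := fun u hu => by
        by_cases huv : u = v <;> simp_all [mem_pebbled, applyMove_compute]
      have := (Finset.card_le_card e).trans (Finset.card_insert_le _ _)
      simp [computeCount, deleteCount, List.filter_cons, isCompute, isDelete] at *
      omega
    | delete v =>
      have e : pebbled (applyMove c (.delete v)) ⊆ (pebbled c).erase v := fun u hu => by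
        by_cases huv : u = v <;> simp_all [mem_pebbled, applyMove_delete]
      have := Finset.card_le_card e
      have := Finset.card_erase_add_one (mem_pebbled.2 hl)
      simp [computeCount, deleteCount, List.filter_cons, isCompute, isDelete] at *
      omega

theorem IsPebbling.deleteCount_le_computeCount {ms : List (Move V)}
    (h : IsPebbling edge R ms) : deleteCount ms ≤ computeCount ms := by
  simpa [pebbled, initConfig] using h.1.deleteCount_le

end Counting

theorem Acyclic.wellFounded [Finite V] {edge : V → V → Prop} (hacyc : Acyclic edge) :
    WellFounded edge := by
  have : Std.Irrefl (Relation.TransGen edge) := ⟨hacyc⟩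
  exact Subrelation.wf Relation.TransGen.single
    (Finite.wellFounded_of_trans_of_irrefl (Relation.TransGen edge))

section Reach

variable [DecidableEq V]

theorem runMoves_append (c : Config V) (ms ms' : List (Move V)) :
    runMoves c (ms ++ ms') = runMoves (runMoves c ms) ms' := by
  induction ms generalizing c with
  | nil => rfl
  | cons m ms ih => exact ih _

variable [Fintype V] {edge : V → V → Prop} {R : ℕ}

theorem validFrom_append {c : Config V} {ms ms' : List (Move V)} :
    ValidFrom edge R c (ms ++ ms') ↔
      ValidFrom edge R c ms ∧ ValidFrom edge R (runMoves c ms) ms' := by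
  induction ms generalizing c with
  | nil => simp [ValidFrom, runMoves]
  | cons m ms ih => simp [ValidFrom, runMoves, ih, and_assoc]

/-- `c'` can be reached from `c` by legal moves comprising `t` transfers and `k` computations. -/
def Reach (edge : V → V → Prop) (R : ℕ) (c c' : Config V) (t k : ℕ) : Prop :=
  ∃ ms, ValidFrom edge R c ms ∧ runMoves c ms = c' ∧ cost ms = t ∧ computeCount ms = k

theorem Reach.refl (c : Config V) : Reach edge R c c 0 0 :=
  ⟨[], trivial, rfl, rfl, rfl⟩

theorem Reach.trans {c c' c'' : Config V} {t k t' k' : ℕ}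
    (h : Reach edge R c c' t k) (h' : Reach edge R c' c'' t' k') :
    Reach edge R c c'' (t + t') (k + k') := by
  obtain ⟨ms, hv, rfl, rfl, rfl⟩ := h
  obtain ⟨ms', hv', rfl, rfl, rfl⟩ := h'
  exact ⟨ms ++ ms', validFrom_append.2 ⟨hv, hv'⟩, runMoves_append _ _ _, cost_append _ _,
    computeCount_append _ _⟩

theorem Reach.of_move {c c' : Config V} (m : Move V) (hl : legalMove edge c m)
    (hc : applyMove c m = c') (hr : redCount c' ≤ R) :
    Reach edge R c c' (cost [m]) (computeCount [m]) :=
  ⟨[m], ⟨hl, hc.symm ▸ hr, trivial⟩, hc, rfl, rfl⟩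

/-- Red pebbles on `Q`, blue pebbles on the rest of `S`. -/
def redBlue (S Q : Finset V) : Config V := fun v =>
  if v ∈ Q then some .red else if v ∈ S then some .blue else none

theorem redCount_redBlue (S Q : Finset V) : redCount (redBlue S Q) = Q.card := by
  unfold redCount
  congr 1
  ext v
  by_cases h : v ∈ Q <;> simp [redBlue, h]

theorem reach_load (S P : Finset V) (hP : P ⊆ S) (hR : P.card ≤ R) :
    Reach edge R (redBlue S ∅) (redBlue S P) P.card 0 := by
  induction P using Finset.induction_on with
  | empty => exact Reach.refl _
  | insert a P ha ih =>
    have haS := hP (Finset.mem_insert_self a P)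
    have hc := Finset.card_insert_of_notMem ha
    have h := ih ((Finset.subset_insert a P).trans hP) (by omega)
    rw [hc]
    refine h.trans (Reach.of_move (.toRed a) ?_ ?_ ?_)
    · simp [legalMove, redBlue, ha, haS]
    · funext u
      by_cases hu : u = a
      · subst hu; simp [applyMove_toRed, redBlue]
      · simp [applyMove_toRed, redBlue, hu]
    · rwa [redCount_redBlue]

theorem reach_compute (S P : Finset V) (v : V) (hv : v ∉ P) (hP : ∀ u, edge u v → u ∈ P)
    (hR : P.card + 1 ≤ R) :
    Reach edge R (redBlue S P) (redBlue S (insert v P)) 0 1 := by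
  refine Reach.of_move (.compute v) ?_ ?_ ?_
  · intro u hu
    simp [redBlue, hP u hu]
  · funext u
    by_cases hu : u = v
    · subst hu; simp [applyMove_compute, redBlue]
    · simp [applyMove_compute, redBlue, hu]
  · rwa [redCount_redBlue, Finset.card_insert_of_notMem hv]

theorem reach_store (S Q : Finset V) (hR : Q.card ≤ R) :
    Reach edge R (redBlue S Q) (redBlue (S ∪ Q) ∅) Q.card 0 := by
  induction Q using Finset.induction_on generalizing S with
  | empty => simpa using Reach.refl _
  | insert a Q ha ih =>
    have hc := Finset.card_insert_of_notMem ha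
    have h := ih (insert a S) (by omega)
    rw [Finset.insert_union, ← Finset.union_insert] at h
    rw [hc, add_comm]
    refine (Reach.of_move (c' := redBlue (insert a S) Q) (.toBlue a) ?_ ?_ ?_).trans h
    · simp [legalMove, redBlue]
    · funext u
      by_cases hu : u = a
      · subst hu; simp [applyMove_toBlue, redBlue, ha]
      · simp [applyMove_toBlue, redBlue, hu]
    · rw [redCount_redBlue]; omega

/-- Loading the in-neighbors of `v`, computing `v` and storing everything again. -/
theorem reach_insert {S : Finset V} {v : V} (hv : v ∉ S) (hS : ∀ u, edge u v → u ∈ S)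
    (hR : indeg edge v + 1 ≤ R) :
    Reach edge R (redBlue S ∅) (redBlue (insert v S) ∅) (2 * indeg edge v + 1) 1 := by
  set P : Finset V := Finset.univ.filter fun u => edge u v with hPdef
  have hPS : P ⊆ S := fun u hu => hS u (by simpa [hPdef] using hu)
  have hvP : v ∉ P := fun h => hv (hPS h)
  have hcard : P.card = indeg edge v := rfl
  have hins := Finset.card_insert_of_notMem hvP
  have h := ((reach_load (edge := edge) (R := R) S P hPS (by omega)).trans
    (reach_compute S P v hvP (fun u hu => by simpa [hPdef] using hu) (by omega))).trans
    (reach_store S (insert v P) (by rw [hins]; omega))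
  rw [Finset.union_insert, Finset.union_eq_left.2 hPS] at h
  convert h using 1
  omega

theorem exists_reach_of_le_card (hacyc : Acyclic edge) {Δ : ℕ} (hΔ : ∀ v, indeg edge v ≤ Δ)
    (hR : Δ + 1 ≤ R) {k : ℕ} (hk : k ≤ Fintype.card V) :
    ∃ S : Finset V, S.card = k ∧ (∀ u v, edge u v → v ∈ S → u ∈ S) ∧
      ∃ t ≤ (2 * Δ + 1) * k, Reach edge R initConfig (redBlue S ∅) t k := by
  induction k with
  | zero => exact ⟨∅, rfl, by simp, 0, by simp, Reach.refl _⟩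
  | succ k ih =>
    obtain ⟨S, hcard, hclosed, t, ht, hreach⟩ := ih (by omega)
    obtain ⟨w, hw⟩ : ∃ w, w ∉ S := by
      by_contra! hall
      have := Finset.card_univ (α := V)
      rw [← Finset.eq_univ_iff_forall.2 hall] at this
      omega
    obtain ⟨v, hv, hmin⟩ := hacyc.wellFounded.has_min {v | v ∉ S} ⟨w, hw⟩
    have hpred : ∀ u, edge u v → u ∈ S := fun u hu => by
      by_contra h
      exact hmin u h hu
    have hdeg := hΔ v
    refine ⟨insert v S, by rw [Finset.card_insert_of_notMem hv, hcard], ?_, _, ?_,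
      hreach.trans (reach_insert hv hpred (by omega))⟩
    · intro a b hab hb
      rcases Finset.mem_insert.1 hb with rfl | hb
      · exact Finset.mem_insert_of_mem (hpred a hab)
      · exact Finset.mem_insert_of_mem (hclosed a b hab hb)
    · rw [mul_add, mul_one]
      omega

theorem exists_isPebbling (hacyc : Acyclic edge) {Δ : ℕ} (hΔ : ∀ v, indeg edge v ≤ Δ)
    (hR : Δ + 1 ≤ R) :
    ∃ ms, IsPebbling edge R ms ∧ cost ms ≤ (2 * Δ + 1) * Fintype.card V ∧
      computeCount ms = Fintype.card V := by
  obtain ⟨S, hcard, -, t, ht, ms, hv, hrun, rfl, hcomp⟩ :=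
    exists_reach_of_le_card hacyc hΔ hR le_rfl
  refine ⟨ms, ⟨hv, fun v _ => ?_⟩, ht, hcomp⟩
  rw [hrun, (Finset.card_eq_iff_eq_univ S).1 hcard]
  simp [redBlue]

end Reach

/-- In the compcost model (with `0 < ε < 1` and `R ≥ Δ + 1`),
every minimum-cost valid pebbling with `R` red pebbles has at most
`(2/ε)·(2Δ + 1 + ε)·n` moves of types (3) and (4) in total; consequently it
consists of at most `(1 + 2/ε)·(2Δ + 1 + ε)·n` moves in total. -/
theorem compcost_optimal_length_bound
    {V : Type} [Fintype V] [DecidableEq V] (edge : V → V → Prop)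
    (hacyc : Acyclic edge) (Δ R : ℕ) (ε : ℝ) (hε0 : 0 < ε) (hε1 : ε < 1)
    (hΔ : ∀ v, indeg edge v ≤ Δ) (hR : Δ + 1 ≤ R)
    (moves : List (Move V))
    (hpeb : IsPebbling edge R moves)
    (hopt : ∀ moves' : List (Move V),
      IsPebbling edge R moves' → ccCost ε moves ≤ ccCost ε moves') :
    ((computeCount moves + deleteCount moves : ℕ) : ℝ) ≤
        (2 / ε) * (2 * (Δ : ℝ) + 1 + ε) * (Fintype.card V : ℝ) ∧
    (moves.length : ℝ) ≤
        (1 + 2 / ε) * (2 * (Δ : ℝ) + 1 + ε) * (Fintype.card V : ℝ) := by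
  obtain ⟨ms, hms, hcost, hcomp⟩ := exists_isPebbling hacyc hΔ hR
  have hcost' : (cost ms : ℝ) ≤ (2 * Δ + 1) * Fintype.card V := by exact_mod_cast hcost
  have hle := hopt ms hms
  simp only [ccCost, hcomp] at hle
  have hdel : (deleteCount moves : ℝ) ≤ computeCount moves := by
    exact_mod_cast hpeb.deleteCount_le_computeCount
  set C : ℝ := (2 * (Δ : ℝ) + 1 + ε) * (Fintype.card V : ℝ) with hC
  have htotal : (cost moves : ℝ) + ε * computeCount moves ≤ C := by rw [hC]; linarith
  have hcost0 : (0 : ℝ) ≤ cost moves := Nat.cast_nonneg _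
  have hcomp0 : 0 ≤ ε * (computeCount moves : ℝ) := by positivity
  have hcd : ((computeCount moves + deleteCount moves : ℕ) : ℝ) ≤ 2 / ε * C := by
    rw [div_mul_eq_mul_div, le_div_iff₀ hε0]
    push_cast
    nlinarith
  have hlen : (moves.length : ℝ) =
      cost moves + ((computeCount moves + deleteCount moves : ℕ) : ℝ) := by
    exact_mod_cast length_eq_cost_add_computeCount_add_deleteCount moves
  rw [mul_assoc, mul_assoc, ← hC]
  exact ⟨hcd, by rw [hlen]; linarith⟩

end RBPebble
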